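/- arXiv:1211.2483 — 4 statements merged into one kernel-verified Lean document; each statement's English description precedes it below -/
import Mathlib

section
/- Let E be a real normed vector space, let K be a compact subset of E, and let x ∈ E with x ∉ K. Then the region occluded by K from x, i.e. the set {x + t • (p − x) : p ∈ K, t ∈ ℝ, 1 ≤ t}, is a closed subset of E. -/
/-- The region occluded by a compact set `K` from a point `x ∉ K`
(a truncated unbounded cone with apex `x` and base `K`) is closed. -/
theorem occluded_region_isClosed {E : Type*} [NormedAddCommGroup E] [NormedSpace ℝ E]
    (K : Set E) (hK : IsCompact K) (x : E) (hx : x ∉ K) :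
    IsClosed {y : E | ∃ p ∈ K, ∃ t : ℝ, 1 ≤ t ∧ y = x + t • (p - x)} := by
  have hc : IsClosed {q : (Set.Icc (0:ℝ) 1) × E | x + (q.1 : ℝ) • (q.2 - x) ∈ K} :=
    hK.isClosed.preimage
      (f := fun q : (Set.Icc (0:ℝ) 1) × E => x + (q.1 : ℝ) • (q.2 - x)) (by fun_prop)
  have h := isClosedMap_snd_of_compactSpace _ hc
  convert h using 1
  ext y
  constructor
  · rintro ⟨p, hp, t, ht, rfl⟩
    have ht0 : t ≠ 0 := by linarith
    refine ⟨(⟨t⁻¹, by positivity, inv_le_one_of_one_le₀ ht⟩, _), ?_, rfl⟩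
    simpa [smul_smul, ht0] using hp
  · rintro ⟨⟨⟨s, hs0, hs1⟩, z⟩, hz, rfl⟩
    simp only [Set.mem_setOf_eq] at hz
    have hs : s ≠ 0 := by
      rintro rfl
      exact hx (by simpa using hz)
    have hpos : 0 < s := lt_of_le_of_ne hs0 hs.symm
    exact ⟨_, hz, s⁻¹, (one_le_inv₀ hpos).2 hs1, by simp [smul_smul, hs]⟩
end

section
/- Let E be a real normed vector space, let P ⊆ E be an open set, and let x ∈ P. Then the visibility region of x with respect to P, namely the set {y ∈ E : the closed segment [x, y] is contained in P}, is an open subset of E. -/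
/-- The visibility region of an interior point `x` of an open set `P`
(the set of `y` such that the closed segment `[x, y]` lies in `P`) is open. -/
theorem visibility_region_isOpen {E : Type*} [NormedAddCommGroup E] [NormedSpace ℝ E]
    (P : Set E) (hP : IsOpen P) (x : E) (hx : x ∈ P) :
    IsOpen {y : E | segment ℝ x y ⊆ P} := by
  rw [isOpen_iff_mem_nhds]
  intro y hy
  have hc : Continuous (fun p : E × ℝ => x + p.2 • (p.1 - x)) := by fun_prop
  have key := (isCompact_Icc (a := (0 : ℝ)) (b := 1)).eventually_forall_of_forall_eventually
    (x₀ := y) (P := fun z t => x + t • (z - x) ∈ P) (by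
      intro t ht
      refine hc.continuousAt.eventually_mem (hP.mem_nhds ?_)
      apply hy
      rw [segment_eq_image']
      exact ⟨t, ht, rfl⟩)
  filter_upwards [key] with z hz
  change segment ℝ x z ⊆ P
  rw [segment_eq_image']
  rintro _ ⟨t, ht, rfl⟩
  exact hz t ht
end

section
/- Let E be a real normed vector space, let P ⊆ E be an open set, let x ∈ P, and suppose the frontier (topological boundary) of P is the union of a finite family K₁, …, Kₙ of compact subsets of E. Then the visibility region of x with respect to P equals the complement of the union over i of the regions occluded by Kᵢ from x; that is, {y ∈ E : [x, y] ⊆ P} = E \ ⋃ᵢ {x + t • (p − x) : p ∈ Kᵢ, t ∈ ℝ, 1 ≤ t}. -/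
/-- If the frontier of an open set `P` is a finite union of compact sets `K i`,
then the visibility region of an interior point `x` equals the complement of the
union of the regions occluded by the `K i` from `x`. -/
theorem visibility_eq_compl_occluded {E : Type*} [NormedAddCommGroup E] [NormedSpace ℝ E]
    (P : Set E) (hP : IsOpen P) (x : E) (hx : x ∈ P)
    (n : ℕ) (K : Fin n → Set E) (hK : ∀ i, IsCompact (K i))
    (hfr : frontier P = ⋃ i, K i) :
    {y : E | segment ℝ x y ⊆ P} =
      (Set.univ : Set E) \
        ⋃ i, {y : E | ∃ p ∈ K i, ∃ t : ℝ, 1 ≤ t ∧ y = x + t • (p - x)} := by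
  ext y
  have hdisj : ∀ p ∈ frontier P, p ∉ P := by
    intro p hp hpP
    rw [hP.frontier_eq] at hp
    exact hp.2 hpP
  simp only [Set.mem_ofPred_eq, Set.mem_sdiff, Set.mem_univ, true_and, Set.mem_iUnion]
  constructor
  · rintro h ⟨i, p, hp, t, ht, rfl⟩
    have ht0 : t ≠ 0 := by positivity
    have hpf : p ∈ frontier P := by
      rw [hfr]
      exact Set.mem_iUnion.2 ⟨i, hp⟩
    refine hdisj p hpf (h ?_)
    rw [segment_eq_image']
    refine ⟨t⁻¹, ⟨by positivity, inv_le_one_of_one_le₀ ht⟩, ?_⟩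
    simp [smul_smul, inv_mul_cancel₀ ht0]
  · intro h
    by_contra hsub
    obtain ⟨z, hz, hzP⟩ := Set.not_subset.1 hsub
    obtain ⟨p, hps, hpf⟩ : ∃ p ∈ segment ℝ x y, p ∈ frontier P := by
      by_contra hno
      push Not at hno
      have hout : ∀ w ∈ segment ℝ x y, w ∉ P → w ∈ (closure P)ᶜ := by
        intro w hw hwP hwc
        refine hno w hw ?_
        rw [hP.frontier_eq]
        exact ⟨hwc, hwP⟩
      obtain ⟨w, -, hw1, hw2⟩ := (convex_segment (𝕜 := ℝ) x y).isPreconnected P (closure P)ᶜ hP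
        isClosed_closure.isOpen_compl
        (fun w hw => (em (w ∈ P)).imp id (hout w hw))
        ⟨x, left_mem_segment ℝ x y, hx⟩ ⟨z, hz, hout z hz hzP⟩
      exact hw2 (subset_closure hw1)
    have hpP := hdisj p hpf
    rw [hfr] at hpf
    obtain ⟨i, hi⟩ := Set.mem_iUnion.1 hpf
    rw [segment_eq_image'] at hps
    obtain ⟨s, ⟨hs0, hs1⟩, rfl⟩ := hps
    have hs : s ≠ 0 := by
      rintro rfl
      simp [hx] at hpP
    have hs0' : 0 < s := lt_of_le_of_ne hs0 hs.symm
    exact h ⟨i, _, hi, s⁻¹, (one_le_inv₀ hs0').2 hs1, by simp [smul_smul, inv_mul_cancel₀ hs]⟩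
end

section
/- Let E be a real normed vector space, let P ⊆ E be an open set, and let X ⊆ P be any subset. Then the visibility region of X with respect to P, namely the set {y ∈ E : there exists x ∈ X such that the closed segment [x, y] is contained in P}, is an open subset of E. -/
/-- The visibility region of a subset `X` of an open set `P`
(the set of points seen by at least one point of `X`) is open. -/
theorem visibility_region_set_isOpen {E : Type*} [NormedAddCommGroup E] [NormedSpace ℝ E]
    (P : Set E) (hP : IsOpen P) (X : Set E) (hX : X ⊆ P) :
    IsOpen {y : E | ∃ x ∈ X, segment ℝ x y ⊆ P} := by
  rw [isOpen_iff_eventually]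
  rintro y ⟨x, hx, hxy⟩
  have key : ∀ᶠ z in nhds y, ∀ t ∈ Set.Icc (0 : ℝ) 1, x + t • (z - x) ∈ P := by
    apply isCompact_Icc.eventually_forall_of_forall_eventually
    intro t ht
    have hc : Continuous (fun p : E × ℝ => x + p.2 • (p.1 - x)) := by fun_prop
    refine hc.continuousAt.eventually_mem (hP.mem_nhds (hxy ?_))
    rw [segment_eq_image']
    exact ⟨t, ht, rfl⟩
  filter_upwards [key] with z hz
  refine ⟨x, hx, ?_⟩
  rw [segment_eq_image']
  rintro _ ⟨t, ht, rfl⟩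
  exact hz t ht
end
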